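/- Let S be a finite set of keys hashed independently and uniformly into a table of m cells, with load α = |S|/m, and fix a key x. Let N be the length of the maximal run (consecutive sequence of occupied cells under linear probing) containing cell h(x). For any constant k and α bounded away from 1, E[N^k] = O_k(1); in particular, for each ℓ ≥ 0, Pr[N ∈ [2^{ℓ+2}, 2^{ℓ+3})] ≤ 12 · e^{-δ²α2^ℓ/3} for suitable constant δ with (1+δ)α < 1. -/

import Mathlib

open scoped Classical

/-- Cyclic distance from `a` to `b`, going forward, modulo `m`. -/
def cdist {m : ℕ} (a b : Fin m) : ℕ :=
  ((b : ℕ) + m - (a : ℕ)) % m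

/-- Cell `i` is occupied under linear probing of the keys of `S` hashed by `f`:
there is an interval of some length `L ≥ 1` ending at `i` receiving at least `L` keys. -/
noncomputable def occupied {U : Type*} {m : ℕ} (S : Finset U) (f : U → Fin m)
    (i : Fin m) : Prop :=
  ∃ L : ℕ, 1 ≤ L ∧ L ≤ m ∧ L ≤ (S.filter (fun y => cdist (f y) i < L)).card

/-- The length of the maximal run of occupied cells containing cell `c`
(`0` if `c` is not occupied). -/
noncomputable def runLen {U : Type*} {m : ℕ} (S : Finset U) (f : U → Fin m)
    (c : Fin m) : ℕ :=
  sSup {L : ℕ | ∃ a : Fin m, cdist a c < L ∧ L ≤ m ∧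
    ∀ j : Fin m, cdist a j < L → occupied S f j}

section Combinatorics

variable {U : Type*} {m : ℕ}

lemma cdist_eq_ite (a b : Fin m) :
    cdist a b = if (a : ℕ) ≤ b then (b : ℕ) - a else (b : ℕ) + m - a := by
  unfold cdist
  have ha := a.2
  have hb := b.2
  split_ifs with h
  · have : (b : ℕ) + m - a = (b - a) + m := by omega
    rw [this, Nat.add_mod_right, Nat.mod_eq_of_lt (by omega)]
  · rw [Nat.mod_eq_of_lt (by omega)]

lemma cdist_lt (a b : Fin m) : cdist a b < m := Nat.mod_lt _ a.pos

lemma cdist_right_injective (a : Fin m) : Function.Injective (cdist a) := by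
  intro b c h
  rw [cdist_eq_ite, cdist_eq_ite] at h
  have ha := a.2
  have hb := b.2
  have hc := c.2
  apply Fin.ext
  split_ifs at h <;> omega

/-- The residue of `n + p` given the residue of `n`, for a shift `p ≤ m`. -/
lemma add_mod_cases {n p a : ℕ} (hm : 0 < m) (ha : n % m = a) (hp : p ≤ m) :
    (a + p < m ∧ (n + p) % m = a + p) ∨ (m ≤ a + p ∧ (n + p) % m + m = a + p) := by
  have ham : a < m := ha ▸ Nat.mod_lt _ hm
  have h : (n + p) % m = (a + p) % m := by rw [← ha, Nat.mod_add_mod]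
  rcases lt_or_ge (a + p) m with hlt | hge
  · exact Or.inl ⟨hlt, by rw [h, Nat.mod_eq_of_lt hlt]⟩
  · rcases lt_or_ge (a + p - m) m with h1 | h1
    · refine Or.inr ⟨hge, ?_⟩
      rw [h, Nat.mod_eq_sub_mod hge, Nat.mod_eq_of_lt h1]
      omega
    · omega

lemma cdist_eq_iff {n p : ℕ} {a b : Fin m} (ha : n % m = a) (hp : p < m) :
    cdist a b = p ↔ (b : ℕ) = (n + p) % m := by
  have h1 := add_mod_cases a.pos ha hp.le
  have h2 := a.2
  have h3 := b.2
  rw [cdist_eq_ite]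
  split_ifs <;> omega

/-- The number of keys hashed to the cells `0, …, n - 1` of the periodic unrolling of the table. -/
noncomputable def prefixLoad (S : Finset U) (f : U → Fin m) (n : ℕ) : ℕ :=
  ∑ i ∈ Finset.range n, (S.filter (fun y => (f y : ℕ) = i % m)).card

variable (S : Finset U) (f : U → Fin m)

lemma prefixLoad_add {n L : ℕ} {a : Fin m} (ha : n % m = a) (hL : L ≤ m) :
    prefixLoad S f (n + L) =
      prefixLoad S f n + (S.filter (fun y => cdist a (f y) < L)).card := by
  induction L with
  | zero => simp
  | succ L ih =>
    rw [← add_assoc, prefixLoad, Finset.sum_range_succ, ← prefixLoad, ih (by omega), add_assoc]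
    congr 1
    rw [← Finset.card_union_of_disjoint]
    · congr 1
      ext y
      have := cdist_eq_iff (b := f y) ha (p := L) (by omega)
      simp only [Finset.mem_union, Finset.mem_filter, ← this, ← and_or_left, and_congr_right_iff]
      omega
    · rw [Finset.disjoint_filter]
      intro y _ h
      rw [← cdist_eq_iff (b := f y) ha (p := L) (by omega)]
      omega

lemma prefixLoad_add_period {n : ℕ} (hm : 0 < m) :
    prefixLoad S f (n + m) = prefixLoad S f n + S.card := by
  rw [prefixLoad_add S f (a := ⟨n % m, Nat.mod_lt _ hm⟩) rfl le_rfl]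
  simp [cdist_lt]

lemma occupied_iff {n : ℕ} {i : Fin m} (hi : n % m = i) (hn : m ≤ n + 1) :
    occupied S f i ↔
      ∃ L, 1 ≤ L ∧ L ≤ m ∧ prefixLoad S f (n + 1 - L) + L ≤ prefixLoad S f (n + 1) := by
  refine exists_congr fun L => and_congr_right fun h1 => and_congr_right fun h2 => ?_
  have hm := i.pos
  have e : n + 1 - L + L = n + 1 := by omega
  have h := prefixLoad_add S f (n := n + 1 - L) (L := L) (a := ⟨_, Nat.mod_lt _ hm⟩) rfl h2
  rw [e] at h
  rw [h, Nat.add_le_add_iff_left]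
  have hset : ∀ y, cdist (f y) i < L ↔ cdist ⟨(n + 1 - L) % m, Nat.mod_lt _ hm⟩ (f y) < L := by
    intro y
    have h3 := add_mod_cases (n := n + 1 - L) (p := L - 1) hm rfl (by omega)
    have e' : n + 1 - L + (L - 1) = n := by omega
    rw [e', hi] at h3
    have h4 := (f y).2
    have h5 := i.2
    have h6 := Nat.mod_lt (n + 1 - L) hm
    rw [cdist_eq_ite, cdist_eq_ite]
    simp only
    split_ifs <;> omega
  simp only [hset]

lemma exists_not_occupied (hS : S.card < m) : ∃ i, ¬ occupied S f i := by
  have hm : 0 < m := by omega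
  have hdrift : ∀ t, prefixLoad S f (t * m) + t ≤ t * m := by
    intro t
    induction t with
    | zero => simp [prefixLoad]
    | succ t ih =>
      rw [Nat.succ_mul, prefixLoad_add_period S f hm]
      omega
  have hex : ∃ j, prefixLoad S f j + m < j := by
    refine ⟨(m + 1) * m, ?_⟩
    have := hdrift (m + 1)
    omega
  classical
  have hj := Nat.find_spec hex
  set j := Nat.find hex with hjdef
  refine ⟨⟨(j - 1) % m, Nat.mod_lt _ hm⟩, ?_⟩
  rw [occupied_iff S f (n := j - 1) rfl (by omega)]
  rintro ⟨L, h1, h2, h3⟩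
  have e : j - 1 + 1 = j := by omega
  rw [e] at h3
  have := Nat.find_min hex (m := j - L) (by omega)
  omega

/-- A maximal run of length `n` receives at least `n` keys, provided the table is not full. -/
lemma exists_le_card_of_runLen_eq {c : Fin m} {n : ℕ} (hS : S.card < m) (hn : 0 < n)
    (hrun : runLen S f c = n) :
    n ≤ m ∧ ∃ a : Fin m, cdist a c < n ∧ n ≤ (S.filter (fun y => cdist a (f y) < n)).card := by
  have hm : 0 < m := by omega
  unfold runLen at hrun
  set R := {L : ℕ | ∃ a : Fin m, cdist a c < L ∧ L ≤ m ∧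
    ∀ j : Fin m, cdist a j < L → occupied S f j} with hR
  have hbdd : BddAbove R := ⟨m, by rintro L ⟨a, -, h, -⟩; exact h⟩
  have hne : R.Nonempty := by
    by_contra h
    rw [Set.not_nonempty_iff_eq_empty] at h
    simp only [h, csSup_empty, bot_eq_zero'] at hrun
    omega
  have hmem : n ∈ R := hrun ▸ Nat.sSup_mem hne hbdd
  obtain ⟨a, hac, hnm, hocc⟩ := hmem
  refine ⟨hnm, a, hac, ?_⟩
  have hlt : n < m := by
    refine lt_of_le_of_ne hnm fun h => ?_
    obtain ⟨i, hi⟩ := exists_not_occupied S f hS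
    exact hi (hocc i (h ▸ cdist_lt a i))
  have ha : ((a : ℕ) + m) % m = a := by rw [Nat.add_mod_right, Nat.mod_eq_of_lt a.2]
  have hprev : ¬ occupied S f ⟨((a : ℕ) + m - 1) % m, Nat.mod_lt _ hm⟩ := by
    intro h
    have h3 := add_mod_cases (n := (a : ℕ) + m - 1) (p := 1) hm rfl (by omega)
    have e : (a : ℕ) + m - 1 + 1 = a + m := by omega
    rw [e, ha] at h3
    have h6 := Nat.mod_lt ((a : ℕ) + m - 1) hm
    have h7 := a.2
    have hsucc : n + 1 ∈ R := by
      refine ⟨⟨((a : ℕ) + m - 1) % m, Nat.mod_lt _ hm⟩, ?_, hlt, ?_⟩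
      · have h5 := c.2
        rw [cdist_eq_ite] at hac ⊢
        simp only
        split_ifs at hac ⊢ <;> omega
      · intro j hj
        by_cases hj' : (j : ℕ) = ((a : ℕ) + m - 1) % m
        · rwa [show j = ⟨((a : ℕ) + m - 1) % m, Nat.mod_lt _ hm⟩ from Fin.ext hj']
        · apply hocc
          have h5 := j.2
          rw [cdist_eq_ite] at hj ⊢
          simp only at hj
          split_ifs at hj ⊢ <;> omega
    have := le_csSup hbdd hsucc
    omega
  rw [occupied_iff S f (n := a + m - 1) rfl (by omega)] at hprev
  push Not at hprev
  have e : (a : ℕ) + m - 1 + 1 = a + m := by omega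
  rw [e] at hprev
  have hpre : ∀ p ≤ n, prefixLoad S f (a + m) + p ≤ prefixLoad S f (a + m + p) := by
    intro p
    induction p using Nat.strong_induction_on with
    | _ p ih =>
      intro hp
      rcases Nat.eq_zero_or_pos p with rfl | hpos
      · simp
      · have hi := hocc ⟨((a : ℕ) + m + (p - 1)) % m, Nat.mod_lt _ hm⟩ (by
          rw [(cdist_eq_iff ha (p := p - 1) (by omega)).2 rfl]
          omega)
        rw [occupied_iff S f (n := a + m + (p - 1)) rfl (by omega)] at hi
        obtain ⟨L, h1, h2, h3⟩ := hi
        rw [show (a : ℕ) + m + (p - 1) + 1 = a + m + p by omega] at h3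
        rcases le_or_gt L p with hLp | hLp
        · have := ih (p - L) (by omega) (by omega)
          rw [show (a : ℕ) + m + (p - L) = a + m + p - L by omega] at this
          omega
        · have := hprev (L - p) (by omega) (by omega)
          rw [show (a : ℕ) + m - (L - p) = a + m + p - L by omega] at this
          omega
  have h := hpre n le_rfl
  rw [prefixLoad_add S f ha hnm] at h
  omega

end Combinatorics

section Probability

variable {U : Type*} [Fintype U] [DecidableEq U] {m : ℕ}

lemma card_filter_cdist_lt_le (a : Fin m) (n : ℕ) :
    (Finset.univ.filter (fun j => cdist a j < n)).card ≤ n := by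
  calc _ ≤ (Finset.range n).card :=
        Finset.card_le_card_of_injOn (cdist a) (by intro j; simp)
          (cdist_right_injective a).injOn
    _ = n := Finset.card_range n

/-- Chernoff bound for the load of a fixed window of `n` cells, jointly with the event that `x`
is hashed into the window. -/
lemma card_window_le {S : Finset U} {x : U} (hx : x ∉ S) {α₀ : ℝ} (hα0 : 0 < α₀) (hα1 : α₀ < 1)
    (hS : (S.card : ℝ) ≤ α₀ * m) (a : Fin m) (n : ℕ) :
    ((Finset.univ.filter (fun f : U → Fin m =>
        cdist a (f x) < n ∧ n ≤ (S.filter (fun y => cdist a (f y) < n)).card)).card : ℝ) ≤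
      n / m * (α₀ * Real.exp (1 - α₀)) ^ n * (m : ℝ) ^ Fintype.card U := by
  have hm : (0 : ℝ) < m := by exact_mod_cast a.pos
  have hT : 1 ≤ α₀⁻¹ := (one_le_inv₀ hα0).2 hα1.le
  set ψ : U → Fin m → ℝ := fun y j =>
    if y = x then (if cdist a j < n then 1 else 0)
    else if y ∈ S then (if cdist a j < n then α₀⁻¹ else 1) else 1 with hψ
  have hψ0 : ∀ y j, 0 ≤ ψ y j := by
    intro y j
    simp only [hψ]
    split_ifs <;> positivity
  have hcard : ((Finset.univ.filter (fun j => cdist a j < n)).card : ℝ) ≤ n := by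
    exact_mod_cast card_filter_cdist_lt_le a n
  have hprod : ∀ f : U → Fin m, cdist a (f x) < n →
      ∏ y, ψ y (f y) = α₀⁻¹ ^ (S.filter (fun y => cdist a (f y) < n)).card := by
    intro f hf
    rw [← Finset.prod_const, Finset.prod_filter, ← Finset.prod_subset (Finset.subset_univ S)]
    · refine Finset.prod_congr rfl fun y hy => ?_
      have : y ≠ x := fun h => hx (h ▸ hy)
      simp [hψ, this, hy]
    · intro y _ hy
      by_cases h : y = x
      · subst h
        simp [hψ, hf]
      · simp [hψ, h, hy]
  have hmarkov : ∀ f : U → Fin m,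
      (if cdist a (f x) < n ∧ n ≤ (S.filter (fun y => cdist a (f y) < n)).card
        then (1 : ℝ) else 0) ≤ α₀ ^ n * ∏ y, ψ y (f y) := by
    intro f
    split_ifs with h
    · rw [hprod f h.1]
      calc (1 : ℝ) = α₀ ^ n * α₀⁻¹ ^ n := by rw [← mul_pow, mul_inv_cancel₀ hα0.ne', one_pow]
        _ ≤ _ := by gcongr; exact h.2
    · exact mul_nonneg (by positivity) (Finset.prod_nonneg fun y _ => hψ0 y _)
  have hsum : ∀ y, ∑ j, ψ y j ≤
      m * ((if y = x then (n / m : ℝ) else 1) *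
        (if y ∈ S then Real.exp (n / m * (α₀⁻¹ - 1)) else 1)) := by
    intro y
    by_cases h : y = x
    · subst h
      simp only [hψ, if_true, hx, if_false, mul_one, Finset.sum_boole]
      rwa [mul_div_cancel₀ _ hm.ne']
    · by_cases hy : y ∈ S
      · simp only [hψ, h, hy, if_true, if_false, one_mul]
        have e : ∀ j : Fin m, (if cdist a j < n then α₀⁻¹ else 1) =
            1 + (α₀⁻¹ - 1) * (if cdist a j < n then 1 else 0) := by
          intro j
          split_ifs <;> ring
        simp only [e, Finset.sum_add_distrib, ← Finset.mul_sum, Finset.sum_boole,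
          Finset.sum_const, Finset.card_univ, Fintype.card_fin, nsmul_eq_mul, mul_one]
        calc (m : ℝ) + (α₀⁻¹ - 1) * _ ≤ m + (α₀⁻¹ - 1) * n := by
              gcongr
          _ = m * (n / m * (α₀⁻¹ - 1) + 1) := by field_simp; ring
          _ ≤ _ := by gcongr; exact Real.add_one_le_exp _
      · simp [hψ, h, hy]
  have htotal : ∏ y, (m * ((if y = x then (n / m : ℝ) else 1) *
        (if y ∈ S then Real.exp (n / m * (α₀⁻¹ - 1)) else 1))) =
      (m : ℝ) ^ Fintype.card U * (n / m * Real.exp (n / m * (α₀⁻¹ - 1)) ^ S.card) := by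
    rw [Finset.prod_mul_distrib, Finset.prod_mul_distrib, Finset.prod_const, Finset.card_univ,
      Finset.prod_ite_eq', Finset.prod_ite_mem]
    simp
  have hexp : Real.exp (n / m * (α₀⁻¹ - 1)) ^ S.card ≤ Real.exp (1 - α₀) ^ n := by
    rw [← Real.exp_nat_mul, ← Real.exp_nat_mul]
    apply Real.exp_le_exp.2
    calc (S.card : ℝ) * (n / m * (α₀⁻¹ - 1)) ≤ (α₀ * m) * (n / m * (α₀⁻¹ - 1)) := by
          gcongr
      _ = n * (1 - α₀) := by field_simp
  calc _ = ∑ f : U → Fin m,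
        (if cdist a (f x) < n ∧ n ≤ (S.filter (fun y => cdist a (f y) < n)).card
          then (1 : ℝ) else 0) := by rw [Finset.sum_boole]
    _ ≤ ∑ f : U → Fin m, α₀ ^ n * ∏ y, ψ y (f y) := Finset.sum_le_sum fun f _ => hmarkov f
    _ = α₀ ^ n * ∏ y, ∑ j, ψ y j := by
        rw [← Finset.mul_sum, Finset.prod_univ_sum, Fintype.piFinset_univ]
    _ ≤ α₀ ^ n * ((m : ℝ) ^ Fintype.card U *
          (n / m * Real.exp (n / m * (α₀⁻¹ - 1)) ^ S.card)) := by
        rw [← htotal]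
        gcongr with y
        exact hsum y
    _ ≤ α₀ ^ n * ((m : ℝ) ^ Fintype.card U * (n / m * Real.exp (1 - α₀) ^ n)) := by gcongr
    _ = _ := by rw [mul_pow]; ring

lemma card_runLen_eq_le {S : Finset U} {x : U} (hx : x ∉ S) {α₀ : ℝ} (hα0 : 0 < α₀)
    (hα1 : α₀ < 1) (hm : 0 < m) (hS : (S.card : ℝ) ≤ α₀ * m) {n : ℕ} (hn : 0 < n) :
    ((Finset.univ.filter (fun f : U → Fin m => runLen S f (f x) = n)).card : ℝ) ≤
      n * (α₀ * Real.exp (1 - α₀)) ^ n * (m : ℝ) ^ Fintype.card U := by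
  have hm' : (0 : ℝ) < m := by exact_mod_cast hm
  have hSm : S.card < m := by
    have : (S.card : ℝ) < m := by nlinarith
    exact_mod_cast this
  have hsub : Finset.univ.filter (fun f : U → Fin m => runLen S f (f x) = n) ⊆
      Finset.univ.biUnion fun a : Fin m => Finset.univ.filter (fun f : U → Fin m =>
        cdist a (f x) < n ∧ n ≤ (S.filter (fun y => cdist a (f y) < n)).card) := by
    intro f hf
    simp only [Finset.mem_filter, Finset.mem_univ, true_and, Finset.mem_biUnion] at hf ⊢
    exact (exists_le_card_of_runLen_eq S f hSm hn hf).2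
  calc _ ≤ ∑ a : Fin m, ((Finset.univ.filter (fun f : U → Fin m =>
        cdist a (f x) < n ∧ n ≤ (S.filter (fun y => cdist a (f y) < n)).card)).card : ℝ) := by
        exact_mod_cast (Finset.card_le_card hsub).trans Finset.card_biUnion_le
    _ ≤ ∑ _a : Fin m, n / m * (α₀ * Real.exp (1 - α₀)) ^ n * (m : ℝ) ^ Fintype.card U :=
        Finset.sum_le_sum fun a _ => card_window_le hx hα0 hα1 hS a n
    _ = _ := by
        rw [Finset.sum_const, Finset.card_univ, Fintype.card_fin, nsmul_eq_mul]
        field_simp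

/-- The expectation of a nonnegative function of the run length. -/
lemma expect_runLen_le {S : Finset U} {x : U} (hx : x ∉ S) {α₀ : ℝ} (hα0 : 0 < α₀)
    (hα1 : α₀ < 1) (hm : 0 < m) (hS : (S.card : ℝ) ≤ α₀ * m) {g : ℕ → ℝ} (hg : ∀ n, 0 ≤ g n)
    (hsum : Summable fun n : ℕ => g n * (n * (α₀ * Real.exp (1 - α₀)) ^ n)) :
    (∑ f : U → Fin m, g (runLen S f (f x))) / (Fintype.card (U → Fin m) : ℝ) ≤
      g 0 + ∑' n : ℕ, g n * (n * (α₀ * Real.exp (1 - α₀)) ^ n) := by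
  have hm' : (0 : ℝ) < m := by exact_mod_cast hm
  have hcard : (Fintype.card (U → Fin m) : ℝ) = (m : ℝ) ^ Fintype.card U := by simp
  have hpos : (0 : ℝ) < (m : ℝ) ^ Fintype.card U := by positivity
  set N : (U → Fin m) → ℕ := fun f => runLen S f (f x) with hN
  have hfib : ∑ f, g (N f) = ∑ n ∈ Finset.univ.image N,
      g n * ((Finset.univ.filter fun f => N f = n).card : ℝ) := by
    rw [Finset.sum_comp g N]
    simp [mul_comm]
  have hterm : ∀ n, g n * ((Finset.univ.filter fun f => N f = n).card : ℝ) ≤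
      ((if n = 0 then g 0 else 0) + g n * (n * (α₀ * Real.exp (1 - α₀)) ^ n)) *
        (m : ℝ) ^ Fintype.card U := by
    intro n
    rcases Nat.eq_zero_or_pos n with rfl | hn
    · simp only [if_true, Nat.cast_zero, zero_mul, mul_zero, add_zero]
      rw [← hcard]
      gcongr
      · exact hg 0
      · exact Finset.card_le_univ _
    · rw [if_neg hn.ne', zero_add, mul_assoc]
      exact mul_le_mul_of_nonneg_left (card_runLen_eq_le hx hα0 hα1 hm hS hn) (hg n)
  rw [hcard, div_le_iff₀ hpos, hfib]
  calc _ ≤ ∑ n ∈ Finset.univ.image N,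
        ((if n = 0 then g 0 else 0) + g n * (n * (α₀ * Real.exp (1 - α₀)) ^ n)) *
          (m : ℝ) ^ Fintype.card U := Finset.sum_le_sum fun n _ => hterm n
    _ ≤ _ := by
        rw [← Finset.sum_mul, Finset.sum_add_distrib]
        gcongr
        · rw [Finset.sum_ite_eq']
          split_ifs
          exacts [le_rfl, hg 0]
        · exact hsum.sum_le_tsum _ fun n _ => mul_nonneg (hg n) (by positivity)

/-- Exponential tail of the run length. -/
lemma card_le_runLen_le {S : Finset U} {x : U} (hx : x ∉ S) {α₀ r : ℝ} (hα0 : 0 < α₀)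
    (hα1 : α₀ < 1) (hm : 0 < m) (hS : (S.card : ℝ) ≤ α₀ * m) (hr0 : 0 < r) (hr1 : r ≤ 1)
    (hsum : Summable fun n : ℕ => r⁻¹ ^ n * (n * (α₀ * Real.exp (1 - α₀)) ^ n)) (M : ℕ) :
    ((Finset.univ.filter (fun f : U → Fin m => M ≤ runLen S f (f x))).card : ℝ) /
        (Fintype.card (U → Fin m) : ℝ) ≤
      r ^ M * (1 + ∑' n : ℕ, r⁻¹ ^ n * (n * (α₀ * Real.exp (1 - α₀)) ^ n)) := by
  have h := expect_runLen_le hx hα0 hα1 hm hS (g := fun n => r⁻¹ ^ n)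
    (fun n => by positivity) hsum
  rw [pow_zero] at h
  refine le_trans ?_ (mul_le_mul_of_nonneg_left h (by positivity))
  rw [← mul_div_assoc]
  gcongr
  rw [Finset.mul_sum, ← Finset.sum_boole]
  refine Finset.sum_le_sum fun f _ => ?_
  split_ifs with hf
  · calc (1 : ℝ) = r ^ M * r⁻¹ ^ M := by rw [← mul_pow, mul_inv_cancel₀ hr0.ne', one_pow]
      _ ≤ _ := by
        gcongr
        exact (one_le_inv₀ hr0).2 hr1
  · positivity

end Probability

/-- A bound by `1` and by a decaying exponential with a large constant gives a slower decaying
exponential with the constant `12`. -/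
lemma exists_rate_of_le_min {A r : ℝ} (hA : 1 ≤ A) (hr0 : 0 < r) (hr1 : r < 1) :
    ∃ ε > 0, ∀ (P : ℝ) (M : ℕ), P ≤ 1 → P ≤ r ^ M * A → P ≤ 12 * Real.exp (-(ε * M)) := by
  have hlog : 0 ≤ Real.log A := Real.log_nonneg hA
  have hr : Real.log r < 0 := Real.log_neg hr0 hr1
  set s : ℝ := 1 / (1 + Real.log A) with hs
  have hs0 : 0 < s := by positivity
  have hs1 : s ≤ 1 := by rw [hs, div_le_one (by positivity)]; linarith
  have hsA : s * Real.log A ≤ 1 := by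
    rw [hs, div_mul_eq_mul_div, one_mul, div_le_one (by positivity)]
    linarith
  refine ⟨s * -Real.log r, mul_pos hs0 (by linarith), fun P M h1 h2 => ?_⟩
  have hP : P ≤ Real.exp (s * (M * Real.log r + Real.log A)) := by
    rcases le_total 0 (M * Real.log r + Real.log A) with h | h
    · exact h1.trans (Real.one_le_exp (by positivity))
    · refine h2.trans ?_
      calc r ^ M * A = Real.exp (M * Real.log r + Real.log A) := by
            rw [Real.exp_add, Real.exp_log (by linarith), ← Real.log_pow,
              Real.exp_log (by positivity)]
        _ ≤ _ := Real.exp_le_exp.2 (by nlinarith)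
  calc P ≤ Real.exp (1 + -(s * -Real.log r * M)) :=
        hP.trans (Real.exp_le_exp.2 (by linarith))
    _ = Real.exp 1 * Real.exp (-(s * -Real.log r * M)) := Real.exp_add _ _
    _ ≤ _ := by
        gcongr
        linarith [Real.exp_one_lt_d9]

theorem stmt10 (k : ℕ) (α₀ : ℝ) (hα0 : 0 < α₀) (hα1 : α₀ < 1) :
    ∃ C δ : ℝ, 0 < δ ∧ δ < 1 ∧ (1 + δ) * α₀ < 1 ∧
      ∀ (m : ℕ), 0 < m → ∀ (U : Type) (_ : Fintype U) (_ : DecidableEq U)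
        (S : Finset U) (x : U), x ∉ S → (S.card : ℝ) ≤ α₀ * m →
        -- E[N^k] = O_k(1): bounded by the constant C
        (∑ f : U → Fin m, ((runLen S f (f x) : ℝ)) ^ k) /
            (Fintype.card (U → Fin m) : ℝ) ≤ C ∧
        -- tail bound: Pr[N ∈ [2^(ℓ+2), 2^(ℓ+3))] ≤ 12 e^{-δ²α2^ℓ/3}
        ∀ ℓ : ℕ,
          ((Finset.univ.filter (fun f : U → Fin m =>
              2 ^ (ℓ + 2) ≤ runLen S f (f x) ∧ runLen S f (f x) < 2 ^ (ℓ + 3))).card : ℝ) /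
              (Fintype.card (U → Fin m) : ℝ)
            ≤ 12 * Real.exp (-(δ ^ 2 * ((S.card : ℝ) / m) * 2 ^ ℓ) / 3) := by
  set q : ℝ := α₀ * Real.exp (1 - α₀) with hq
  have hq0 : 0 < q := by positivity
  have hq1 : q < 1 := by
    have h := Real.add_one_lt_exp (x := α₀ - 1) (by linarith)
    rw [hq, show 1 - α₀ = -(α₀ - 1) by ring, Real.exp_neg, ← div_eq_mul_inv,
      div_lt_one (Real.exp_pos _)]
    linarith
  obtain ⟨r, hqr, hr1⟩ := exists_between hq1
  have hr0 : 0 < r := hq0.trans hqr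
  have hsum1 : Summable fun n : ℕ => (n : ℝ) ^ k * (n * q ^ n) := by
    refine (summable_pow_mul_geometric_of_norm_lt_one (k + 1) (r := q) ?_).congr fun n => by ring
    rwa [Real.norm_of_nonneg hq0.le]
  have hsum2 : Summable fun n : ℕ => r⁻¹ ^ n * (n * q ^ n) := by
    refine (summable_pow_mul_geometric_of_norm_lt_one 1 (r := r⁻¹ * q) ?_).congr fun n => by
      rw [mul_pow]; ring
    rw [Real.norm_of_nonneg (by positivity), inv_mul_lt_one₀ hr0]
    exact hqr
  obtain ⟨ε, hε, hrate⟩ := exists_rate_of_le_min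
    (A := 1 + ∑' n : ℕ, r⁻¹ ^ n * (n * q ^ n))
    (le_add_of_nonneg_right (tsum_nonneg fun n => by positivity)) hr0 hr1
  have hδ0 : 0 < min (1 / 2) (min ε ((1 - α₀) / 2)) := by
    refine lt_min (by norm_num) (lt_min hε (by linarith))
  have hδ1 : min (1 / 2) (min ε ((1 - α₀) / 2)) ≤ 1 / 2 := min_le_left _ _
  have hδ2 : min (1 / 2) (min ε ((1 - α₀) / 2)) ≤ ε :=
    (min_le_right _ _).trans (min_le_left _ _)
  have hδ3 : min (1 / 2) (min ε ((1 - α₀) / 2)) ≤ (1 - α₀) / 2 :=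
    (min_le_right _ _).trans (min_le_right _ _)
  generalize min (1 / 2) (min ε ((1 - α₀) / 2)) = δ at hδ0 hδ1 hδ2 hδ3
  refine ⟨(0 : ℕ) ^ k + ∑' n : ℕ, (n : ℝ) ^ k * (n * q ^ n), δ, hδ0, by linarith,
    by nlinarith, fun m hm U _ _ S x hx hS => ⟨?_, fun ℓ => ?_⟩⟩
  · exact expect_runLen_le hx hα0 hα1 hm hS (g := fun n => (n : ℝ) ^ k)
      (fun n => by positivity) hsum1
  · have hm' : (0 : ℝ) < m := by exact_mod_cast hm
    have hα : (S.card : ℝ) / m ≤ 1 := by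
      rw [div_le_one hm']
      nlinarith
    have hP : ((Finset.univ.filter (fun f : U → Fin m =>
        2 ^ (ℓ + 2) ≤ runLen S f (f x) ∧ runLen S f (f x) < 2 ^ (ℓ + 3))).card : ℝ) /
          (Fintype.card (U → Fin m) : ℝ) ≤ 12 * Real.exp (-(ε * (2 ^ (ℓ + 2) : ℕ))) := by
      apply hrate
      · exact div_le_one_of_le₀ (by exact_mod_cast Finset.card_le_univ _) (by positivity)
      · refine le_trans ?_ (card_le_runLen_le hx hα0 hα1 hm hS hr0 hr1.le hsum2 _)
        gcongr with f
        exact fun h => h.1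
    refine hP.trans ?_
    gcongr
    rw [neg_div]
    gcongr
    push_cast
    have h2 : δ ^ 2 * ((S.card : ℝ) / m) ≤ ε := by
      calc δ ^ 2 * ((S.card : ℝ) / m) ≤ δ ^ 2 * 1 := by gcongr
        _ ≤ ε := by nlinarith
    have h3 : δ ^ 2 * ((S.card : ℝ) / m) * 2 ^ ℓ ≤ ε * 2 ^ ℓ := by gcongr
    have h4 : 0 < ε * 2 ^ ℓ := by positivity
    rw [pow_add]
    linarith
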